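/- Let N be a finite ground set, 𝒦₀ ⊆ 𝒦 ⊆ 2^N, and let (f, 𝒦) with f(∅) = 0 admit at least one subadditive extension. For each nonempty S ⊆ N define the set function f^S by f^S(T) := f̲_𝒦(T) if S ⊆ T and f^S(T) := f̄_𝒦(T) otherwise, and f^S(∅) := 0. Then f^S is a subadditive extension of (f, 𝒦). Consequently, the completions are tight: for every T ∉ 𝒦 there exist subadditive extensions g̲ and ḡ of (f, 𝒦) with g̲(T) = f̲_𝒦(T) and ḡ(T) = f̄_𝒦(T). -/

import Mathlib

open Finset

/-- The minimal information family: the empty set, the ground set, and all singletons. -/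
def K0 (N : Type*) [Fintype N] : Set (Finset N) :=
  {∅, (Finset.univ : Finset N)} ∪ {S : Finset N | ∃ i : N, S = {i}}

/-- A set function is subadditive if `f (S ∪ T) ≤ f S + f T` for disjoint `S`, `T`. -/
def SubadditiveSF {N : Type*} [DecidableEq N] (f : Finset N → ℝ) : Prop :=
  ∀ S T : Finset N, Disjoint S T → f (S ∪ T) ≤ f S + f T

/-- A set function is monotone if `S ⊆ T` implies `f S ≤ f T`. -/
def MonotoneSF {N : Type*} (f : Finset N → ℝ) : Prop :=
  ∀ S T : Finset N, S ⊆ T → f S ≤ f T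

/-- Elementwise monotonicity: `f S ≤ f (S ∪ {i})`. -/
def MonotoneStep {N : Type*} [DecidableEq N] (f : Finset N → ℝ) : Prop :=
  ∀ (S : Finset N) (i : N), i ∉ S → f S ≤ f (insert i S)

/-- Upper completion: minimum of `∑ f Sᵢ` over families of pairwise disjoint nonempty
sets `Sᵢ ∈ K` partitioning `S`; it is `0` at `∅`. -/
noncomputable def upperC {N : Type*} [DecidableEq N] (f : Finset N → ℝ)
    (K : Set (Finset N)) (S : Finset N) : ℝ :=
  if S = ∅ then 0 else
    sInf {x : ℝ | ∃ P : Finset (Finset N),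
      (∀ T ∈ P, T ∈ K) ∧ (∀ T ∈ P, T ≠ ∅) ∧
      (∀ T₁ ∈ P, ∀ T₂ ∈ P, T₁ ≠ T₂ → Disjoint T₁ T₂) ∧
      P.sup id = S ∧ x = ∑ T ∈ P, f T}

/-- Lower completion: maximum of `f T - upperC f K (T \ S)` over `T ∈ K` with `S ⊆ T`. -/
noncomputable def lowerC {N : Type*} [DecidableEq N] (f : Finset N → ℝ)
    (K : Set (Finset N)) (S : Finset N) : ℝ :=
  sSup {x : ℝ | ∃ T ∈ K, S ⊆ T ∧ x = f T - upperC f K (T \ S)}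

/-- The ℓ¹-divergence of `f` with revealed family `K ⊆ 2^N \ K0`. -/
noncomputable def ldiv {N : Type*} [Fintype N] [DecidableEq N] (f : Finset N → ℝ)
    (K : Set (Finset N)) : ℝ :=
  ∑ T : Finset N, (upperC f (K0 N ∪ K) T - lowerC f (K0 N ∪ K) T)

/-- SAM upper completion: minimum of `∑ f Sᵢ` over nonempty finite families
`S₁, …, S_k ∈ K` covering `S`. -/
noncomputable def samUpper {N : Type*} [DecidableEq N] (f : Finset N → ℝ)
    (K : Set (Finset N)) (S : Finset N) : ℝ :=
  sInf {x : ℝ | ∃ (k : ℕ) (Ss : Fin (k + 1) → Finset N),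
    (∀ i, Ss i ∈ K) ∧ S ⊆ Finset.univ.sup Ss ∧ x = ∑ i, f (Ss i)}

/-- SAM lower completion. -/
noncomputable def samLower {N : Type*} [DecidableEq N] (f : Finset N → ℝ)
    (K : Set (Finset N)) (S : Finset N) : ℝ :=
  max (sSup {x : ℝ | ∃ Y ∈ K, Y ⊆ S ∧ x = f Y})
      (sSup {x : ℝ | ∃ X ∈ K, S ⊆ X ∧ x = f X - samUpper f K (X \ S)})

/-- The SAM ℓ¹-divergence. -/
noncomputable def samDiv {N : Type*} [Fintype N] [DecidableEq N] (f : Finset N → ℝ)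
    (K : Set (Finset N)) : ℝ :=
  ∑ T : Finset N, (samUpper f (K0 N ∪ K) T - samLower f (K0 N ∪ K) T)

/-- `{(α i, T i)}` is a fractional cover of `S`. -/
def IsFracCover {N : Type*} [DecidableEq N] (S : Finset N) (k : ℕ)
    (α : Fin k → ℝ) (T : Fin k → Finset N) : Prop :=
  (∀ i, 0 < α i) ∧
  ∀ j ∈ S, (1 : ℝ) ≤ ∑ i ∈ Finset.univ.filter (fun i => j ∈ T i), α i

/-- A set function is fractionally subadditive. -/
def FracSubadditive {N : Type*} [DecidableEq N] (f : Finset N → ℝ) : Prop :=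
  ∀ (S : Finset N) (k : ℕ) (α : Fin k → ℝ) (T : Fin k → Finset N),
    IsFracCover S k α T → f S ≤ ∑ i, α i * f (T i)

/-- XOS: pointwise maximum of finitely many nonnegative additive set functions. -/
def IsXOS {N : Type*} (f : Finset N → ℝ) : Prop :=
  ∃ (s : ℕ) (a : Fin (s + 1) → N → ℝ),
    (∀ i j, 0 ≤ a i j) ∧
    ∀ S : Finset N, f S = Finset.univ.sup' Finset.univ_nonempty (fun i => ∑ j ∈ S, a i j)

/-- XOS upper completion: infimum of `∑ αᵢ f Tᵢ` over fractional covers of `S`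
using sets from `K`. -/
noncomputable def xosUpper {N : Type*} [DecidableEq N] (f : Finset N → ℝ)
    (K : Set (Finset N)) (S : Finset N) : ℝ :=
  sInf {x : ℝ | ∃ (k : ℕ) (α : Fin k → ℝ) (T : Fin k → Finset N),
    IsFracCover S k α T ∧ (∀ i, T i ∈ K) ∧ x = ∑ i, α i * f (T i)}

/-- For a nonempty `S`, the glued function `f^S`: lower completion on supersets of `S`,
upper completion elsewhere, `0` at `∅`. -/
noncomputable def cutExt {N : Type*} [DecidableEq N] (f : Finset N → ℝ)
    (K : Set (Finset N)) (S : Finset N) : Finset N → ℝ :=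
  fun T => if T = ∅ then 0 else if S ⊆ T then lowerC f K T else upperC f K T

/-- `P` partitions `S` into nonempty members of `K`. -/
def IsKPartition {N : Type*} [DecidableEq N] (K : Set (Finset N)) (P : Finset (Finset N))
    (S : Finset N) : Prop :=
  (∀ T ∈ P, T ∈ K) ∧ (∀ T ∈ P, T ≠ ∅) ∧
    (∀ T₁ ∈ P, ∀ T₂ ∈ P, T₁ ≠ T₂ → Disjoint T₁ T₂) ∧ P.sup id = S

section Completions

variable {N : Type*} [DecidableEq N] {f g : Finset N → ℝ} {K : Set (Finset N)}

theorem upperC_empty : upperC f K ∅ = 0 := by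
  simp [upperC]

theorem IsKPartition.union {P Q : Finset (Finset N)} {A B : Finset N}
    (hP : IsKPartition K P A) (hQ : IsKPartition K Q B) (hAB : Disjoint A B) :
    Disjoint P Q ∧ IsKPartition K (P ∪ Q) (A ∪ B) := by
  obtain ⟨hPK, hPne, hPd, rfl⟩ := hP
  obtain ⟨hQK, hQne, hQd, rfl⟩ := hQ
  have cross : ∀ T₁ ∈ P, ∀ T₂ ∈ Q, Disjoint T₁ T₂ := fun T₁ h₁ T₂ h₂ =>
    hAB.mono (Finset.le_sup (f := id) h₁) (Finset.le_sup (f := id) h₂)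
  refine ⟨Finset.disjoint_left.2 fun T h₁ h₂ => hPne T h₁ (disjoint_self.1 (cross T h₁ T h₂)),
    ?_, ?_, ?_, Finset.sup_union⟩
  · intro T hT
    exact (Finset.mem_union.1 hT).elim (hPK T) (hQK T)
  · intro T hT
    exact (Finset.mem_union.1 hT).elim (hPne T) (hQne T)
  · intro T₁ h₁ T₂ h₂ hne
    rcases Finset.mem_union.1 h₁ with h₁ | h₁ <;> rcases Finset.mem_union.1 h₂ with h₂ | h₂
    · exact hPd _ h₁ _ h₂ hne
    · exact cross _ h₁ _ h₂
    · exact (cross _ h₂ _ h₁).symm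
    · exact hQd _ h₁ _ h₂ hne

theorem isKPartition_singleton {T : Finset N} (hT : T ∈ K) (hne : T ≠ ∅) :
    IsKPartition K {T} T := by
  refine ⟨by simpa using hT, by simpa using hne, ?_, by simp⟩
  intro T₁ h₁ T₂ h₂ h
  rw [Finset.mem_singleton] at h₁ h₂
  exact absurd (h₁.trans h₂.symm) h

theorem exists_isKPartition (hK : ∀ i : N, {i} ∈ K) (S : Finset N) :
    ∃ P, IsKPartition K P S := by
  induction S using Finset.induction_on with
  | empty => exact ⟨∅, by simp [IsKPartition]⟩
  | insert a S ha ih =>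
    obtain ⟨P, hP⟩ := ih
    exact ⟨_, ((isKPartition_singleton (hK a) (Finset.singleton_ne_empty a)).union hP
      (Finset.disjoint_singleton_left.2 ha)).2⟩

theorem SubadditiveSF.le_sum_isKPartition (hg : SubadditiveSF g) (hg0 : g ∅ = 0)
    {P : Finset (Finset N)} {S : Finset N} (hP : IsKPartition K P S) :
    g S ≤ ∑ T ∈ P, g T := by
  obtain ⟨-, -, hd, rfl⟩ := hP
  induction P using Finset.induction_on with
  | empty => simp [hg0]
  | insert T P hT ih =>
    have hTP : Disjoint T (P.sup id) := Finset.disjoint_sup_right.2 fun T' hT' =>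
      hd _ (Finset.mem_insert_self _ _) _ (Finset.mem_insert_of_mem hT')
        (by rintro rfl; exact hT hT')
    rw [Finset.sup_insert, Finset.sum_insert hT]
    exact (hg _ _ hTP).trans (add_le_add_right (ih fun T₁ h₁ T₂ h₂ =>
      hd _ (Finset.mem_insert_of_mem h₁) _ (Finset.mem_insert_of_mem h₂)) _)

variable [Fintype N]

theorem upperC_le_sum {P : Finset (Finset N)} {S : Finset N} (hP : IsKPartition K P S) :
    upperC f K S ≤ ∑ T ∈ P, f T := by
  obtain ⟨h₁, h₂, h₃, h₄⟩ := hP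
  rcases eq_or_ne S ∅ with rfl | hS
  · have hP : P = ∅ := Finset.eq_empty_of_forall_notMem fun T hT =>
      h₂ T hT (Finset.subset_empty.1 (h₄ ▸ Finset.le_sup (f := id) hT))
    simp [upperC, hP]
  · rw [upperC, if_neg hS]
    refine csInf_le (Set.Finite.bddBelow ?_) ⟨P, h₁, h₂, h₃, h₄, rfl⟩
    refine (Set.finite_range fun P : Finset (Finset N) => ∑ T ∈ P, f T).subset ?_
    rintro x ⟨P, -, -, -, -, rfl⟩
    exact ⟨P, rfl⟩

theorem exists_upperC_eq_sum (hK : ∀ i : N, {i} ∈ K) (S : Finset N) :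
    ∃ P, IsKPartition K P S ∧ upperC f K S = ∑ T ∈ P, f T := by
  rcases eq_or_ne S ∅ with rfl | hS
  · exact ⟨∅, by simp [IsKPartition], by simp [upperC]⟩
  · rw [upperC, if_neg hS]
    set X := {x : ℝ | ∃ P : Finset (Finset N),
      (∀ T ∈ P, T ∈ K) ∧ (∀ T ∈ P, T ≠ ∅) ∧
      (∀ T₁ ∈ P, ∀ T₂ ∈ P, T₁ ≠ T₂ → Disjoint T₁ T₂) ∧
      P.sup id = S ∧ x = ∑ T ∈ P, f T} with hX
    have hfin : X.Finite := by
      refine (Set.finite_range fun P : Finset (Finset N) => ∑ T ∈ P, f T).subset ?_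
      rintro x ⟨P, -, -, -, -, rfl⟩
      exact ⟨P, rfl⟩
    have hne : X.Nonempty := by
      obtain ⟨P, h₁, h₂, h₃, h₄⟩ := exists_isKPartition hK S
      exact ⟨_, P, h₁, h₂, h₃, h₄, rfl⟩
    obtain ⟨P, h₁, h₂, h₃, h₄, h₅⟩ := hne.csInf_mem hfin
    exact ⟨P, ⟨h₁, h₂, h₃, h₄⟩, h₅⟩

theorem subadditiveSF_upperC (hK : ∀ i : N, {i} ∈ K) : SubadditiveSF (upperC f K) := by
  intro A B hAB
  obtain ⟨P, hP, hPs⟩ := exists_upperC_eq_sum (f := f) hK A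
  obtain ⟨Q, hQ, hQs⟩ := exists_upperC_eq_sum (f := f) hK B
  obtain ⟨hd, hU⟩ := hP.union hQ hAB
  rw [hPs, hQs, ← Finset.sum_union hd]
  exact upperC_le_sum hU

theorem SubadditiveSF.le_upperC (hg : SubadditiveSF g) (hgf : ∀ S ∈ K, g S = f S)
    (hg0 : g ∅ = 0) (hK : ∀ i : N, {i} ∈ K) (S : Finset N) : g S ≤ upperC f K S := by
  obtain ⟨P, hP, hPs⟩ := exists_upperC_eq_sum (f := f) hK S
  rw [hPs, ← Finset.sum_congr rfl fun T hT => hgf T (hP.1 T hT)]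
  exact hg.le_sum_isKPartition hg0 hP

theorem sub_upperC_le_lowerC {S T : Finset N} (hT : T ∈ K) (hST : S ⊆ T) :
    f T - upperC f K (T \ S) ≤ lowerC f K S := by
  refine le_csSup (Set.Finite.bddAbove ?_) ⟨T, hT, hST, rfl⟩
  refine (Set.finite_range fun T : Finset N => f T - upperC f K (T \ S)).subset ?_
  rintro x ⟨T, -, -, rfl⟩
  exact ⟨T, rfl⟩

theorem lowerC_le {S : Finset N} {c : ℝ} (hN : Finset.univ ∈ K)
    (h : ∀ T ∈ K, S ⊆ T → f T - upperC f K (T \ S) ≤ c) : lowerC f K S ≤ c := by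
  refine csSup_le ⟨_, Finset.univ, hN, Finset.subset_univ S, rfl⟩ ?_
  rintro x ⟨T, hT, hST, rfl⟩
  exact h T hT hST

theorem SubadditiveSF.lowerC_le (hg : SubadditiveSF g) (hgf : ∀ S ∈ K, g S = f S)
    (hg0 : g ∅ = 0) (hK : ∀ i : N, {i} ∈ K) (hN : Finset.univ ∈ K) (S : Finset N) :
    lowerC f K S ≤ g S := by
  refine _root_.lowerC_le hN fun T hT hST => ?_
  have h₁ := hg S (T \ S) Finset.disjoint_sdiff
  rw [Finset.union_sdiff_of_subset hST, hgf T hT] at h₁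
  linarith [hg.le_upperC hgf hg0 hK (T \ S)]

theorem lowerC_union_le (hK : ∀ i : N, {i} ∈ K) (hN : Finset.univ ∈ K) {A B : Finset N}
    (hAB : Disjoint A B) : lowerC f K (A ∪ B) ≤ lowerC f K A + upperC f K B := by
  refine lowerC_le hN fun T hT hABT => ?_
  have hsplit : T \ (A ∪ B) ∪ B = T \ A := by
    ext x
    have h₁ := @hABT x
    have h₂ : x ∈ A → x ∉ B := fun h => Finset.disjoint_left.1 hAB h
    simp only [Finset.mem_union, Finset.mem_sdiff] at *
    tauto
  have h₁ := subadditiveSF_upperC (f := f) hK (T \ (A ∪ B)) B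
    (Finset.sdiff_disjoint.mono_right Finset.subset_union_right)
  rw [hsplit] at h₁
  have h₂ := sub_upperC_le_lowerC (f := f) hT (Finset.subset_union_left.trans hABT)
  linarith

theorem subadditiveSF_cutExt (hK : ∀ i : N, {i} ∈ K) (hN : Finset.univ ∈ K)
    (hLU : ∀ T, lowerC f K T ≤ upperC f K T) {S : Finset N} (hS : S ≠ ∅) :
    SubadditiveSF (cutExt f K S) := by
  intro A B hAB
  rcases eq_or_ne A ∅ with rfl | hA
  · simp [cutExt]
  rcases eq_or_ne B ∅ with rfl | hB
  · simp [cutExt]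
  have hne : A ∪ B ≠ ∅ := fun h => hA (Finset.union_eq_empty.1 h).1
  simp only [cutExt, if_neg hA, if_neg hB, if_neg hne]
  by_cases hSA : S ⊆ A
  · have hSB : ¬ S ⊆ B := fun h => hS (Finset.subset_empty.1 (hAB hSA h))
    rw [if_pos hSA, if_neg hSB, if_pos (hSA.trans Finset.subset_union_left)]
    exact lowerC_union_le hK hN hAB
  · rw [if_neg hSA]
    by_cases hSB : S ⊆ B
    · rw [if_pos hSB, if_pos (hSB.trans Finset.subset_union_right), Finset.union_comm, add_comm]
      exact lowerC_union_le hK hN hAB.symm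
    · rw [if_neg hSB]
      have hU := subadditiveSF_upperC (f := f) hK A B hAB
      split_ifs
      · exact (hLU _).trans hU
      · exact hU

theorem SubadditiveSF.cutExt_eq (hg : SubadditiveSF g) (hgf : ∀ S ∈ K, g S = f S)
    (hg0 : g ∅ = 0) (hK : ∀ i : N, {i} ∈ K) (hN : Finset.univ ∈ K) (S : Finset N)
    {T : Finset N} (hT : T ∈ K) : cutExt f K S T = f T := by
  rcases eq_or_ne T ∅ with rfl | hne
  · simp [cutExt, ← hgf _ hT, hg0]
  rw [cutExt, if_neg hne]
  split_ifs
  · refine le_antisymm ((hg.lowerC_le hgf hg0 hK hN T).trans_eq (hgf T hT)) ?_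
    simpa [upperC_empty] using sub_upperC_le_lowerC (f := f) hT (Finset.Subset.refl T)
  · refine le_antisymm ?_ ((hgf T hT).symm.trans_le (hg.le_upperC hgf hg0 hK T))
    simpa using upperC_le_sum (f := f) (isKPartition_singleton hT hne)

end Completions

/-- each `f^S` is a subadditive extension of `(f, K)`; consequently the
completions are tight at every unrevealed subset. -/
theorem completions_tight {N : Type*} [Fintype N] [DecidableEq N]
    (f : Finset N → ℝ) (K : Set (Finset N))
    (hK0 : K0 N ⊆ K) (hf0 : f ∅ = 0)
    (hext : ∃ g : Finset N → ℝ, SubadditiveSF g ∧ ∀ S ∈ K, g S = f S) :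
    (∀ S : Finset N, S ≠ ∅ →
      SubadditiveSF (cutExt f K S) ∧ ∀ T ∈ K, cutExt f K S T = f T) ∧
    (∀ T : Finset N, T ∉ K →
      (∃ g : Finset N → ℝ, SubadditiveSF g ∧ (∀ S ∈ K, g S = f S) ∧
        g T = lowerC f K T) ∧
      (∃ g : Finset N → ℝ, SubadditiveSF g ∧ (∀ S ∈ K, g S = f S) ∧
        g T = upperC f K T)) := by
  obtain ⟨g, hg, hgf⟩ := hext
  have hE : ∅ ∈ K := hK0 (by simp [K0])
  have hN : Finset.univ ∈ K := hK0 (by simp [K0])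
  have hK : ∀ i : N, {i} ∈ K := fun i => hK0 (Or.inr ⟨i, rfl⟩)
  have hg0 : g ∅ = 0 := (hgf _ hE).trans hf0
  have hLU : ∀ T, lowerC f K T ≤ upperC f K T := fun T =>
    (hg.lowerC_le hgf hg0 hK hN T).trans (hg.le_upperC hgf hg0 hK T)
  have hcut : ∀ S : Finset N, S ≠ ∅ →
      SubadditiveSF (cutExt f K S) ∧ ∀ T ∈ K, cutExt f K S T = f T := fun S hS =>
    ⟨subadditiveSF_cutExt hK hN hLU hS, fun T hT => hg.cutExt_eq hgf hg0 hK hN S hT⟩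
  refine ⟨hcut, fun T hT => ?_⟩
  have hT0 : T ≠ ∅ := fun h => hT (h ▸ hE)
  have hTN : ¬ Finset.univ ⊆ T := fun h => hT (Finset.univ_subset_iff.1 h ▸ hN)
  have hN0 : (Finset.univ : Finset N) ≠ ∅ := fun h => hTN (h ▸ Finset.empty_subset T)
  exact ⟨⟨_, (hcut T hT0).1, (hcut T hT0).2, by simp [cutExt, hT0]⟩,
    ⟨_, (hcut _ hN0).1, (hcut _ hN0).2, by rw [cutExt, if_neg hT0, if_neg hTN]⟩⟩
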